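/- (Zhang–Yan factorization for symmetric weighted graphs.) Let G be a finite connected weighted multigraph equipped with an involutive automorphism h (h preserves the endpoint map, preserves edge weights, and h ∘ h = id) whose vertex set is partitioned as V_L ∪ V_C ∪ V_R with V_L = {v₁, …, vₙ}, V_R = {v₁', …, vₙ'}, V_C = {w₁, …, w_m} (m ≥ 1), where h(v_i) = v_i' for each i and h fixes each vertex of V_C. Assume every edge of G either has both endpoints in V_L ∪ V_C, or both endpoints in V_R ∪ V_C, or joins v_i to v_i' for some i (in particular no edge joins v_i to v_j' with i ≠ j), and that h maps the set of edges with both endpoints in V_L ∪ V_C bijectively, weight-preservingly, onto the set of edges with both endpoints in V_R ∪ V_C, fixing every edge with both endpoints in V_C and fixing every edge of the form (v_i, v_i'). Define G_R as the induced weighted subgraph of G on V_R ∪ V_C, except that the weight of every edge with both endpoints in V_C is divided by 2. Define G_L as the induced weighted subgraph of G on V_L together with one new vertex u, where additionally for every edge (v_i, v_i') of G of weight ω one adds an edge (u, v_i) of weight 2ω, and for every edge (v_i, w_j) of G of weight ω one adds an edge (u, v_i) of weight ω. Then τ(G) = 2^{m-1} · τ(G_L) · τ(G_R). -/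

import Mathlib

/-- A finite weighted multigraph: finite vertex and edge sets, an endpoint map
assigning to each edge an unordered pair of (not necessarily distinct) vertices,
and a rational weight on each edge. -/
structure WMGraph where
  V : Type
  E : Type
  [fintypeV : Fintype V]
  [decEqV : DecidableEq V]
  [fintypeE : Fintype E]
  [decEqE : DecidableEq E]
  ends : E → Sym2 V
  w : E → ℚ

attribute [instance] WMGraph.fintypeV WMGraph.decEqV WMGraph.fintypeE WMGraph.decEqE

namespace WMGraph

/-- Two vertices are joined by a walk in the subgraph with edge set `T`. -/
def Reach (G : WMGraph) (T : Finset G.E) (x y : G.V) : Prop :=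
  Relation.ReflTransGen (fun u v => ∃ e ∈ T, G.ends e = s(u, v)) x y

/-- The subgraph with edge set `T` is connected (spanning all vertices). -/
def ConnectedOn (G : WMGraph) (T : Finset G.E) : Prop :=
  ∀ x y : G.V, G.Reach T x y

/-- The subgraph with edge set `T` is acyclic: every edge of `T` is a bridge,
i.e. its endpoints are not joined after the edge is removed. -/
def AcyclicOn (G : WMGraph) (T : Finset G.E) : Prop :=
  ∀ e ∈ T, ∀ x y : G.V, G.ends e = s(x, y) → ¬ G.Reach (T.erase e) x y

/-- `T` is a spanning tree: connected and acyclic spanning subgraph. -/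
def IsSpanningTree (G : WMGraph) (T : Finset G.E) : Prop :=
  G.ConnectedOn T ∧ G.AcyclicOn T

open Classical in
/-- The tree weight `τ(G)`: the sum over all spanning trees of the product of
the weights of their edges. -/
noncomputable def treeWeight (G : WMGraph) : ℚ :=
  ∑ T ∈ Finset.univ.filter (fun T : Finset G.E => G.IsSpanningTree T),
    ∏ e ∈ T, G.w e

end WMGraph

theorem Function.Injective.of_image_univ_eq {E ι : Type*} [DecidableEq E] [Fintype ι]
    {f g : ι → E} (hf : Function.Injective f) (h : Finset.univ.image g = Finset.univ.image f) :
    Function.Injective g := by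
  rw [← Set.injOn_univ, ← Finset.coe_univ, ← Finset.card_image_iff, h,
    Finset.card_image_of_injective _ hf]

namespace Matrix

variable {R E ι : Type*} [CommRing R] [Fintype E] [DecidableEq E] [Fintype ι] [DecidableEq ι]

/-- A weighted Cauchy–Binet expansion, indexed by maps rather than by subsets. -/
theorem det_transpose_mul_diagonal_mul_eq_sum (B : Matrix E ι R) (w : E → R) :
    (Bᵀ * diagonal w * B).det =
      ∑ f : ι → E, (∏ i, w (f i)) * ((∏ i, B (f i) i) * (B.submatrix f id).det) := by
  have hrow : Bᵀ * diagonal w * B = fun i => ∑ e : E, (w e * B e i) • B e := by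
    ext i j
    simp only [mul_apply (M := Bᵀ * diagonal w), mul_diagonal, transpose_apply, Finset.sum_apply,
      Pi.smul_apply, smul_eq_mul]
    exact Finset.sum_congr rfl fun e _ => by ring
  rw [hrow]
  change detRowAlternating.toMultilinearMap (fun i => ∑ e : E, (w e * B e i) • B e) = _
  rw [MultilinearMap.map_sum]
  refine Finset.sum_congr rfl fun f _ => ?_
  rw [MultilinearMap.map_smul_univ, Finset.prod_mul_distrib, smul_eq_mul, mul_assoc]
  rfl

/-- The Cauchy–Binet sum over all enumerations of the image of `f` is a squared minor. -/
theorem sum_prod_mul_det_submatrix_eq_sq (B : Matrix E ι R) {f : ι → E}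
    (hf : Function.Injective f) :
    ∑ g : ι → E with Finset.univ.image g = Finset.univ.image f,
        (∏ i, B (g i) i) * (B.submatrix g id).det = (B.submatrix f id).det ^ 2 := by
  have hsum : ∑ g : ι → E with Finset.univ.image g = Finset.univ.image f,
        (∏ i, B (g i) i) * (B.submatrix g id).det =
      ∑ σ : Equiv.Perm ι, (∏ i, B (f (σ i)) i) * (B.submatrix (f ∘ σ) id).det := by
    symm
    refine Finset.sum_bij (fun σ _ => f ∘ σ) ?_ ?_ ?_ (fun _ _ => rfl)
    · intro σ _
      simp only [Finset.mem_filter, Finset.mem_univ, true_and]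
      ext e
      simp only [Finset.mem_image, Finset.mem_univ, true_and, Function.comp_apply]
      exact (σ.surjective.exists (p := fun i => f i = e)).symm
    · intro σ _ σ' _ h
      ext i
      exact hf (congrFun h i)
    · intro g hg
      have hg : Finset.univ.image g = Finset.univ.image f := by simpa using hg
      have hmem : ∀ i, ∃ j, f j = g i := fun i => by
        simpa [hg] using Finset.mem_image_of_mem g (Finset.mem_univ i)
      choose σ hσ using hmem
      have hσinj : Function.Injective σ := fun i j hij =>
        hf.of_image_univ_eq hg (by rw [← hσ i, ← hσ j, hij])
      exact ⟨Equiv.ofBijective σ hσinj.bijective_of_finite, Finset.mem_univ _, funext hσ⟩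
  rw [hsum, sq]
  conv_rhs => enter [1]; rw [det_apply']
  rw [Finset.sum_mul]
  refine Finset.sum_congr rfl fun σ _ => ?_
  have := det_permute σ (B.submatrix f id)
  rw [submatrix_submatrix] at this
  simp only [Function.comp_id] at this
  rw [this]
  simp only [submatrix_apply, id]
  ring

end Matrix

namespace WMGraph

open Matrix

variable {ι : Type*} [Fintype ι] [DecidableEq ι]

/-- The edge–vertex incidence matrix for a chosen orientation, with columns restricted along `φ`. -/
def incidence {V E : Type*} [DecidableEq V] (R : Type*) [Ring R] (src tgt : E → V) (φ : ι → V) :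
    Matrix E ι R :=
  Matrix.of fun e i => (if φ i = src e then 1 else 0) - (if φ i = tgt e then 1 else 0)

omit [Fintype ι] [DecidableEq ι] in
theorem incidence_map_intCast {V E : Type*} [DecidableEq V] (src tgt : E → V) (φ : ι → V) :
    (incidence ℤ src tgt φ).map (Int.castRingHom ℚ) = incidence ℚ src tgt φ := by
  ext e i
  simp [incidence]

theorem incidence_mulVec {V E : Type*} [DecidableEq V] {R : Type*} [CommRing R] (src tgt : E → V)
    {φ : ι → V} (hφ : Function.Injective φ) {r : V} (hr : ∀ v, v ≠ r ↔ ∃ i, φ i = v)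
    (y : V → R) (e : E) :
    (incidence R src tgt φ).mulVec (fun i => y (φ i) - y r) e = y (src e) - y (tgt e) := by
  have key : ∀ v, ∑ i, (if φ i = v then (1 : R) else 0) * (y (φ i) - y r) = y v - y r := by
    intro v
    by_cases hv : v = r
    · have : ∀ i, φ i ≠ v := fun i hi => (hr v).2 ⟨i, hi⟩ hv
      simp only [if_neg (this _), zero_mul, Finset.sum_const_zero]
      simp [hv]
    · obtain ⟨i, rfl⟩ := (hr v).1 hv
      simp [hφ.eq_iff]
  simp only [Matrix.mulVec, dotProduct, incidence, Matrix.of_apply, sub_mul, Finset.sum_sub_distrib,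
    key]
  ring

variable (G : WMGraph) {src tgt : G.E → G.V} {φ : ι → G.V}

theorem Reach.symm {G : WMGraph} {T : Finset G.E} {x y : G.V} (h : G.Reach T x y) :
    G.Reach T y x := by
  have : Std.Symm fun u v => ∃ e ∈ T, G.ends e = s(u, v) :=
    ⟨fun _ _ ⟨e, he, h⟩ => ⟨e, he, h.trans Sym2.eq_swap⟩⟩
  exact Relation.ReflTransGen.stdSymm.symm _ _ h

/-- The coordinate vector of a vertex in the columns chosen by `φ`. -/
def vertexVec {V : Type*} [DecidableEq V] (φ : ι → V) (v : V) : ι → ℤ :=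
  fun i => if φ i = v then 1 else 0

omit [Fintype ι] [DecidableEq ι] in
theorem vertexVec_sub_mem_span (hst : ∀ e, G.ends e = s(src e, tgt e)) {T : Finset G.E} {x y : G.V}
    (h : G.Reach T x y) :
    vertexVec φ x - vertexVec φ y ∈
      Submodule.span ℤ ((incidence ℤ src tgt φ).row '' (T : Set G.E)) := by
  induction h with
  | refl => simp
  | @tail b c _ hbc ih =>
    obtain ⟨e, he, hends⟩ := hbc
    have hmem : (incidence ℤ src tgt φ).row e ∈
        Submodule.span ℤ ((incidence ℤ src tgt φ).row '' (T : Set G.E)) :=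
      Submodule.subset_span ⟨e, he, rfl⟩
    have hinc : (incidence ℤ src tgt φ).row e = vertexVec φ (src e) - vertexVec φ (tgt e) := rfl
    rw [hst, Sym2.eq_iff] at hends
    rw [← sub_add_sub_cancel _ (vertexVec φ b)]
    refine add_mem ih ?_
    rcases hends with ⟨h1, h2⟩ | ⟨h1, h2⟩
    · rwa [← h1, ← h2, ← hinc]
    · rw [← h1, ← h2, ← neg_sub, ← hinc]
      exact neg_mem hmem

theorem ConnectedOn.span_incidence_eq_top {G : WMGraph} {src tgt : G.E → G.V}
    (hst : ∀ e, G.ends e = s(src e, tgt e)) {φ : ι → G.V} (hφ : Function.Injective φ) {r : G.V}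
    (hr : ∀ v, v ≠ r ↔ ∃ i, φ i = v) {T : Finset G.E} (h : G.ConnectedOn T) :
    Submodule.span ℤ ((incidence ℤ src tgt φ).row '' (T : Set G.E)) = ⊤ := by
  rw [eq_top_iff, ← (Pi.basisFun ℤ ι).span_eq, Submodule.span_le]
  rintro _ ⟨i, rfl⟩
  have hvr : vertexVec φ r = 0 := by
    ext j
    have : φ j ≠ r := (hr _).2 ⟨j, rfl⟩
    simp [vertexVec, this]
  have hvi : vertexVec φ (φ i) = Pi.basisFun ℤ ι i := by
    ext j
    simp [vertexVec, hφ.eq_iff, Pi.single_apply]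
  have := vertexVec_sub_mem_span (φ := φ) G hst (h (φ i) r)
  rwa [hvr, hvi, sub_zero] at this

open Classical in
theorem AcyclicOn.linearIndepOn_incidence {G : WMGraph} {src tgt : G.E → G.V}
    (hst : ∀ e, G.ends e = s(src e, tgt e)) {φ : ι → G.V} (hφ : Function.Injective φ) {r : G.V}
    (hr : ∀ v, v ≠ r ↔ ∃ i, φ i = v) {T : Finset G.E} (h : G.AcyclicOn T) :
    LinearIndepOn ℤ (incidence ℤ src tgt φ).row (T : Set G.E) := by
  rw [linearIndepOn_finset_iff]
  intro c hc e he
  let y : G.V → ℤ := fun v => if G.Reach (T.erase e) (src e) v then 1 else 0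
  have h0 := congrArg (fun z => z ⬝ᵥ fun i => y (φ i) - y r) hc
  simp only [sum_dotProduct, smul_dotProduct, zero_dotProduct] at h0
  have hrow : ∀ e', (incidence ℤ src tgt φ).row e' ⬝ᵥ (fun i => y (φ i) - y r) =
      y (src e') - y (tgt e') := incidence_mulVec src tgt hφ hr y
  simp only [hrow] at h0
  rw [Finset.sum_eq_single_of_mem e he] at h0
  · have h1 : y (src e) = 1 := if_pos Relation.ReflTransGen.refl
    have h2 : y (tgt e) = 0 := if_neg (h e he _ _ (hst e))
    simpa [h1, h2] using h0
  · intro e' he' hne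
    have hmem : e' ∈ T.erase e := Finset.mem_erase.2 ⟨hne, he'⟩
    have : G.Reach (T.erase e) (src e) (src e') ↔ G.Reach (T.erase e) (src e) (tgt e') :=
      ⟨fun hh => hh.tail ⟨e', hmem, hst e'⟩,
        fun hh => hh.tail ⟨e', hmem, (hst e').trans Sym2.eq_swap⟩⟩
    simp [y, this]

theorem IsSpanningTree.exists_enumeration {G : WMGraph} {src tgt : G.E → G.V}
    (hst : ∀ e, G.ends e = s(src e, tgt e)) {φ : ι → G.V} (hφ : Function.Injective φ) {r : G.V}
    (hr : ∀ v, v ≠ r ↔ ∃ i, φ i = v) {T : Finset G.E} (h : G.IsSpanningTree T) :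
    ∃ f : ι → G.E, Function.Injective f ∧ Finset.univ.image f = T ∧
      ((incidence ℤ src tgt φ).submatrix f id).det ^ 2 = 1 := by
  have hspan := h.1.span_incidence_eq_top hst hφ hr
  have hli := h.2.linearIndepOn_incidence hst hφ hr
  let b : Module.Basis T ℤ (ι → ℤ) := Module.Basis.mk hli (by
    rw [← hspan, Set.image_eq_range])
  let f : ι ≃ T := (b.indexEquiv (Pi.basisFun ℤ ι)).symm
  have himage : Finset.univ.image (fun i => (f i : G.E)) = T := by
    ext e
    simp only [Finset.mem_image, Finset.mem_univ, true_and]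
    exact ⟨fun ⟨i, hi⟩ => hi ▸ (f i).2, fun he => ⟨f.symm ⟨e, he⟩, by simp⟩⟩
  refine ⟨fun i => f i, Subtype.val_injective.comp f.injective, himage, ?_⟩
  set A := (incidence ℤ src tgt φ).submatrix (fun i => (f i : G.E)) id
  have hrows : Submodule.span ℤ (Set.range A.row) = ⊤ := by
    rw [← hspan]
    congr 1
    ext z
    simp only [Set.mem_range, Set.mem_image, Finset.mem_coe]
    constructor
    · rintro ⟨i, rfl⟩
      exact ⟨f i, (f i).2, rfl⟩
    · rintro ⟨e, he, rfl⟩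
      exact ⟨f.symm ⟨e, he⟩, by ext j; simp [A, Matrix.row]⟩
  have hinv : ∀ i, ∃ c : ι → ℤ, ∑ j, c j • A.row j = Pi.single i 1 := fun i =>
    (Submodule.mem_span_range_iff_exists_fun ℤ).1 (hrows ▸ Submodule.mem_top)
  choose C hC using hinv
  have hmul : Matrix.of C * A = 1 := by
    ext i j
    have := congrFun (hC i) j
    simpa [Matrix.mul_apply, Matrix.one_apply, Pi.single_apply, eq_comm] using this
  have hunit : IsUnit A.det := IsUnit.of_mul_eq_one_right _ (by
    rw [← Matrix.det_mul, hmul, Matrix.det_one])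
  rcases Int.isUnit_iff.1 hunit with h | h <;> simp [h]

open Classical in
theorem isSpanningTree_of_det_ne_zero (hst : ∀ e, G.ends e = s(src e, tgt e))
    (hφ : Function.Injective φ) {r : G.V} (hr : ∀ v, v ≠ r ↔ ∃ i, φ i = v) {f : ι → G.E}
    (hdet : ((incidence ℤ src tgt φ).submatrix f id).det ≠ 0) :
    G.IsSpanningTree (Finset.univ.image f) := by
  set T := Finset.univ.image f
  constructor
  · suffices h : ∀ x, G.Reach T r x from fun x y => (h x).symm.trans (h y)
    by_contra! hx
    obtain ⟨x, hx⟩ := hx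
    let y : G.V → ℤ := fun v => if G.Reach T r v then 1 else 0
    refine hdet (Matrix.exists_mulVec_eq_zero_iff.1 ⟨fun i => y (φ i) - y r, ?_, ?_⟩)
    · have hxr : x ≠ r := by
        rintro rfl
        exact hx Relation.ReflTransGen.refl
      obtain ⟨i, rfl⟩ := (hr x).1 hxr
      intro h0
      have h1 : y r = 1 := if_pos Relation.ReflTransGen.refl
      have h2 : y (φ i) = 0 := if_neg hx
      simpa [h1, h2] using congrFun h0 i
    · ext j
      have hj : f j ∈ T := Finset.mem_image_of_mem f (Finset.mem_univ j)
      have : G.Reach T r (src (f j)) ↔ G.Reach T r (tgt (f j)) :=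
        ⟨fun hh => hh.tail ⟨f j, hj, hst _⟩,
          fun hh => hh.tail ⟨f j, hj, (hst _).trans Sym2.eq_swap⟩⟩
      refine (incidence_mulVec src tgt hφ hr y (f j)).trans ?_
      simp [y, this]
  · intro e he x y hxy hreach
    obtain ⟨i, -, rfl⟩ := Finset.mem_image.1 he
    have hli : LinearIndependent ℤ ((incidence ℤ src tgt φ).submatrix f id).row :=
      Matrix.linearIndependent_rows_of_det_ne_zero hdet
    have hnot := hli.notMem_span_image (s := {i}ᶜ) (x := i) (by simp)
    apply hnot
    have hsub : (incidence ℤ src tgt φ).row '' (T.erase (f i) : Finset G.E) ⊆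
        ((incidence ℤ src tgt φ).submatrix f id).row '' {i}ᶜ := by
      rintro _ ⟨e, he, rfl⟩
      obtain ⟨hne, he⟩ := Finset.mem_erase.1 he
      obtain ⟨j, -, rfl⟩ := Finset.mem_image.1 he
      exact ⟨j, fun hj => hne (congrArg f hj), rfl⟩
    refine Submodule.span_mono hsub ?_
    have hmem := vertexVec_sub_mem_span (φ := φ) G hst hreach
    have hinc : ((incidence ℤ src tgt φ).submatrix f id).row i =
        vertexVec φ (src (f i)) - vertexVec φ (tgt (f i)) := rfl
    rw [hst, Sym2.eq_iff] at hxy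
    rw [hinc]
    rcases hxy with ⟨h1, h2⟩ | ⟨h1, h2⟩
    · rwa [h1, h2]
    · rw [h1, h2, ← neg_sub]
      exact neg_mem hmem

/-- The weighted matrix-tree theorem: the tree weight is the determinant of the Laplacian reduced
at the root `r`. -/
theorem treeWeight_eq_det (hst : ∀ e, G.ends e = s(src e, tgt e))
    (hφ : Function.Injective φ) {r : G.V} (hr : ∀ v, v ≠ r ↔ ∃ i, φ i = v) :
    G.treeWeight =
      ((incidence ℚ src tgt φ)ᵀ * Matrix.diagonal G.w * incidence ℚ src tgt φ).det := by
  classical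
  set B := incidence ℤ src tgt φ with hB
  have hcast : ∀ f : ι → G.E, ((incidence ℚ src tgt φ).submatrix f id).det =
      ((B.submatrix f id).det : ℚ) := by
    intro f
    rw [← incidence_map_intCast, ← hB, Matrix.submatrix_map, ← RingHom.mapMatrix_apply,
      ← RingHom.map_det]
    rfl
  rw [Matrix.det_transpose_mul_diagonal_mul_eq_sum,
    ← Finset.sum_fiberwise Finset.univ (fun f : ι → G.E => Finset.univ.image f), treeWeight,
    Finset.sum_filter]
  refine Finset.sum_congr rfl fun T _ => ?_
  split_ifs with hT
  · obtain ⟨f, hf, rfl, hdet⟩ := hT.exists_enumeration hst hφ hr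
    have hsq := Matrix.sum_prod_mul_det_submatrix_eq_sq (incidence ℚ src tgt φ) hf
    rw [hcast f] at hsq
    rw [show (((B.submatrix f id).det : ℚ)) ^ 2 = 1 by exact_mod_cast hdet] at hsq
    rw [← mul_one (∏ e ∈ _, G.w e), ← hsq, Finset.mul_sum]
    refine Finset.sum_congr rfl fun g hg => ?_
    have hg : Finset.univ.image g = Finset.univ.image f := by simpa using hg
    rw [← hg, Finset.prod_image (hf.of_image_univ_eq hg).injOn]
  · symm
    refine Finset.sum_eq_zero fun f hf => ?_
    have hf : Finset.univ.image f = T := by simpa using hf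
    have : (B.submatrix f id).det = 0 := by
      by_contra hne
      exact hT (hf ▸ isSpanningTree_of_det_ne_zero G hst hφ hr hne)
    simp [hcast, this]

end WMGraph

namespace Matrix

variable {K p q : Type*} [Field K] [Fintype p] [DecidableEq p] [Fintype q] [DecidableEq q]

/-- Splitting a mirror-symmetric block matrix into its antisymmetric and symmetric parts. -/
theorem det_fromBlocks_mirror (h2 : (2 : K) ≠ 0) (X Q : Matrix p p K) (Y : Matrix p q K)
    (Y' : Matrix q p K) (Z : Matrix q q K) :
    (fromBlocks (X + Q) (fromCols Y (-Q)) (fromRows Y' (-Q))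
        (fromBlocks ((2 : K) • Z) Y' Y (X + Q))).det =
      2 ^ Fintype.card q * (X + (2 : K) • Q).det * (fromBlocks Z Y' Y X).det := by
  let U : Matrix (p ⊕ (q ⊕ p)) (p ⊕ (q ⊕ p)) K :=
    fromBlocks 1 (fromCols 0 1) (fromRows 0 (-1)) 1
  have hU : U.det = 2 ^ Fintype.card p := by
    have h : (1 : Matrix (q ⊕ p) (q ⊕ p) K) -
        (fromRows 0 (-1) : Matrix (q ⊕ p) p K) * (fromCols 0 1 : Matrix p (q ⊕ p) K) =
        fromBlocks 1 0 0 ((2 : K) • 1) := by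
      rw [fromRows_mul_fromCols, ← fromBlocks_one, sub_eq_add_neg, fromBlocks_neg, fromBlocks_add]
      simp [two_smul]
    rw [det_fromBlocks_one₁₁, h, det_fromBlocks_zero₂₁, det_smul]
    simp
  have hUL : Uᵀ * fromBlocks (X + Q) (fromCols Y (-Q)) (fromRows Y' (-Q))
        (fromBlocks ((2 : K) • Z) Y' Y (X + Q)) * U =
      fromBlocks ((2 : K) • (X + (2 : K) • Q)) 0 0 ((2 : K) • fromBlocks Z Y' Y X) := by
    ext (i | i | i) (j | j | j) <;>
      simp [U, mul_apply, one_apply, Fintype.sum_sum_type] <;> ring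
  have hdet := congrArg det hUL
  rw [det_mul, det_mul, det_transpose, hU, det_fromBlocks_zero₂₁, det_smul, det_smul,
    Fintype.card_sum, pow_add] at hdet
  have hp : (2 : K) ^ Fintype.card p ≠ 0 := pow_ne_zero _ h2
  refine mul_left_cancel₀ (mul_ne_zero hp hp) ?_
  linear_combination hdet

theorem transpose_mul_diagonal_mul_apply {R E ι κ : Type*} [CommRing R] [Fintype E]
    [DecidableEq E] (B : Matrix E ι R) (B' : Matrix E κ R) (w : E → R) (i : ι) (j : κ) :
    (Bᵀ * diagonal w * B') i j = ∑ e, B e i * w e * B' e j := by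
  simp only [mul_apply (M := Bᵀ * diagonal w), mul_diagonal, transpose_apply]

variable {E₁ EC EA : Type*} [Fintype E₁] [DecidableEq E₁] [Fintype EC] [DecidableEq EC]
  [Fintype EA] [DecidableEq EA]

/-- The determinant factorization for a mirror-symmetric weighted Gram matrix: `A` and `C` are the
mirrored rows, `D` the rows supported on the axis, and `F` the rows crossing the axis. -/
theorem det_mirror_gram (h2 : (2 : K) ≠ 0) (A : Matrix E₁ p K) (C : Matrix E₁ q K)
    (D : Matrix EC q K) (F : Matrix EA p K) (w₁ : E₁ → K) (wC : EC → K) (wA : EA → K)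
    {B : Matrix ((E₁ × Bool) ⊕ (EC ⊕ EA)) (p ⊕ (q ⊕ p)) K}
    (hB : B = of (Sum.elim
      (fun e => if e.2 then Sum.elim 0 (Sum.elim (C e.1) (A e.1))
        else Sum.elim (A e.1) (Sum.elim (C e.1) 0))
      (Sum.elim (fun c => Sum.elim 0 (Sum.elim (D c) 0))
        fun a => Sum.elim (F a) (Sum.elim 0 (-F a))))) :
    (Bᵀ * diagonal (Sum.elim (fun e : E₁ × Bool => w₁ e.1) (Sum.elim wC wA)) * B).det =
      2 ^ Fintype.card q *
        ((fromRows A F)ᵀ * diagonal (Sum.elim w₁ fun a => 2 * wA a) * fromRows A F).det *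
        ((fromBlocks C A D 0)ᵀ * diagonal (Sum.elim w₁ fun c => wC c / 2) *
          fromBlocks C A D 0).det := by
  have key := det_fromBlocks_mirror h2 (Aᵀ * diagonal w₁ * A) (Fᵀ * diagonal wA * F)
    (Aᵀ * diagonal w₁ * C) (Cᵀ * diagonal w₁ * A)
    (Cᵀ * diagonal w₁ * C + (2⁻¹ : K) • (Dᵀ * diagonal wC * D))
  convert key using 3
  · subst hB
    ext (i | i | i) (j | j | j) <;>
      simp [transpose_mul_diagonal_mul_apply, Fintype.sum_sum_type, Fintype.sum_prod_type,
        Finset.sum_add_distrib, h2, two_mul]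
  · congr 1
    ext i j
    simp [transpose_mul_diagonal_mul_apply, Fintype.sum_sum_type, Finset.mul_sum]
    exact Finset.sum_congr rfl fun a _ => by ring
  · ext (i | i) (j | j) <;>
      simp [transpose_mul_diagonal_mul_apply, Fintype.sum_sum_type, Finset.mul_sum]
    exact Finset.sum_congr rfl fun a _ => by ring

end Matrix

/-- **Zhang–Yan factorization for symmetric weighted graphs.**
Let `G` be a finite connected weighted multigraph with an involutive,
weight-preserving automorphism `h`, vertex set partitioned as
`V_L ∪ V_C ∪ V_R` with `V_L = {v₁, …, vₙ}`, `V_R = {v₁', …, vₙ'}`,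
`V_C = {w₁, …, w_m}` (`m ≥ 1`), where `h vᵢ = vᵢ'` and `h` fixes `V_C`.
Every edge has both endpoints in `V_L ∪ V_C`, or both in `V_R ∪ V_C`, or joins
`vᵢ` to `vᵢ'`; `h` pairs the left-half edges weight-preservingly with the
right-half edges, fixing the `V_C`–`V_C` edges and the axis edges `(vᵢ, vᵢ')`.
This is encoded by: `E₁` the left-half edges with at least one endpoint in `V_L`
(appearing in `G` in two mirror copies `E₁ × Bool`), `EC` the `V_C`–`V_C` edges,
and `EA` the edges `(vᵢ, vᵢ')`.  With `G_R` the induced subgraph on `V_R ∪ V_C`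
with the weight of each `V_C`–`V_C` edge halved, and `G_L` the induced subgraph
on `V_L` plus a new vertex `u` (`= none`), with an edge `(u, vᵢ)` of weight `2ω`
for each axis edge `(vᵢ, vᵢ')` of weight `ω` and an edge `(u, vᵢ)` of weight `ω`
for each edge `(vᵢ, wⱼ)` of weight `ω`, we have
`τ(G) = 2^(m-1) · τ(G_L) · τ(G_R)`. -/
theorem tree_weight_involutive_factorization (n m : ℕ) (hm : 1 ≤ m)
    (E₁ EC EA : Type)
    [Fintype E₁] [DecidableEq E₁] [Fintype EC] [DecidableEq EC]
    [Fintype EA] [DecidableEq EA]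
    (ends₁ : E₁ → Sym2 (Fin n ⊕ Fin m)) (w₁ : E₁ → ℚ)
    (hE₁ : ∀ e : E₁, ∃ i : Fin n, Sum.inl i ∈ ends₁ e)
    (endsC : EC → Sym2 (Fin m)) (wC : EC → ℚ)
    (idxA : EA → Fin n) (wA : EA → ℚ) :
    -- the embedding of the left half `V_L ∪ V_C` into `V = V_L ⊕ (V_C ⊕ V_R)`
    let leftEmb : Fin n ⊕ Fin m → Fin n ⊕ (Fin m ⊕ Fin n) := fun v => match v with
      | Sum.inl i => Sum.inl i
      | Sum.inr j => Sum.inr (Sum.inl j)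
    -- the mirror embedding of the right half `V_R ∪ V_C`
    let rightEmb : Fin n ⊕ Fin m → Fin n ⊕ (Fin m ⊕ Fin n) := fun v => match v with
      | Sum.inl i => Sum.inr (Sum.inr i)
      | Sum.inr j => Sum.inr (Sum.inl j)
    -- the symmetric graph `G`
    let G : WMGraph :=
      { V := Fin n ⊕ (Fin m ⊕ Fin n)
        E := (E₁ × Bool) ⊕ (EC ⊕ EA)
        ends := fun e => match e with
          | Sum.inl (e, false) => (ends₁ e).map leftEmb
          | Sum.inl (e, true) => (ends₁ e).map rightEmb
          | Sum.inr (Sum.inl c) => (endsC c).map (fun j => Sum.inr (Sum.inl j))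
          | Sum.inr (Sum.inr a) => s(Sum.inl (idxA a), Sum.inr (Sum.inr (idxA a)))
        w := fun e => match e with
          | Sum.inl (e, _) => w₁ e
          | Sum.inr (Sum.inl c) => wC c
          | Sum.inr (Sum.inr a) => wA a }
    -- `G_R`: induced subgraph on `V_R ∪ V_C`, axis-edge weights halved
    let Gright : WMGraph :=
      { V := Fin n ⊕ Fin m
        E := E₁ ⊕ EC
        ends := fun e => match e with
          | Sum.inl e₁ => ends₁ e₁
          | Sum.inr c => (endsC c).map Sum.inr
        w := fun e => match e with
          | Sum.inl e₁ => w₁ e₁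
          | Sum.inr c => wC c / 2 }
    -- `G_L`: induced subgraph on `V_L` plus new vertex `u = none`
    let Gleft : WMGraph :=
      { V := Option (Fin n)
        E := E₁ ⊕ EA
        ends := fun e => match e with
          | Sum.inl e₁ => (ends₁ e₁).map (fun v => match v with
              | Sum.inl i => some i
              | Sum.inr _ => none)
          | Sum.inr a => s(some (idxA a), none)
        w := fun e => match e with
          | Sum.inl e₁ => w₁ e₁
          | Sum.inr a => 2 * wA a }
    G.ConnectedOn Finset.univ →
      WMGraph.treeWeight G = 2 ^ (m - 1) * WMGraph.treeWeight Gleft * WMGraph.treeWeight Gright := by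
  intro leftEmb rightEmb G Gright Gleft _
  obtain ⟨k, rfl⟩ : ∃ k, m = k + 1 := ⟨m - 1, by omega⟩
  have horient : ∀ {W : Type} (z : Sym2 W), ∃ a b, z = s(a, b) := fun z =>
    Sym2.ind (fun a b => ⟨a, b, rfl⟩) z
  choose s₁ t₁ h₁ using fun e => horient (ends₁ e)
  choose sC tC hC using fun e => horient (endsC e)
  let merge : Fin n ⊕ Fin (k + 1) → Option (Fin n) := Sum.elim some fun _ => none
  let srcG : (E₁ × Bool) ⊕ (EC ⊕ EA) → Fin n ⊕ (Fin (k + 1) ⊕ Fin n) :=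
    Sum.elim (fun e => if e.2 then rightEmb (s₁ e.1) else leftEmb (s₁ e.1))
      (Sum.elim (fun c => Sum.inr (Sum.inl (sC c))) fun a => Sum.inl (idxA a))
  let tgtG : (E₁ × Bool) ⊕ (EC ⊕ EA) → Fin n ⊕ (Fin (k + 1) ⊕ Fin n) :=
    Sum.elim (fun e => if e.2 then rightEmb (t₁ e.1) else leftEmb (t₁ e.1))
      (Sum.elim (fun c => Sum.inr (Sum.inl (tC c))) fun a => Sum.inr (Sum.inr (idxA a)))
  let φG : Fin n ⊕ (Fin k ⊕ Fin n) → Fin n ⊕ (Fin (k + 1) ⊕ Fin n) :=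
    Sum.map id (Sum.map Fin.succ id)
  let srcR : E₁ ⊕ EC → Fin n ⊕ Fin (k + 1) := Sum.elim s₁ fun c => Sum.inr (sC c)
  let tgtR : E₁ ⊕ EC → Fin n ⊕ Fin (k + 1) := Sum.elim t₁ fun c => Sum.inr (tC c)
  let φR : Fin k ⊕ Fin n → Fin n ⊕ Fin (k + 1) := Sum.elim (fun j => Sum.inr j.succ) Sum.inl
  let srcL : E₁ ⊕ EA → Option (Fin n) := Sum.elim (fun e => merge (s₁ e)) fun a => some (idxA a)
  let tgtL : E₁ ⊕ EA → Option (Fin n) := Sum.elim (fun e => merge (t₁ e)) fun _ => none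
  have hG : ∀ e, G.ends e = s(srcG e, tgtG e) := by
    rintro (⟨e, _ | _⟩ | c | a) <;> simp [G, srcG, tgtG, h₁, hC]
  have hR : ∀ e, Gright.ends e = s(srcR e, tgtR e) := by
    rintro (e | c) <;> simp [Gright, srcR, tgtR, h₁, hC]
  have hL : ∀ e, Gleft.ends e = s(srcL e, tgtL e) := by
    rintro (e | a)
    · simp only [Gleft, srcL, tgtL, h₁, Sum.elim_inl, Sym2.map_mk]
      rcases s₁ e with i | i <;> rcases t₁ e with j | j <;> rfl
    · rfl
  have hφG : Function.Injective φG :=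
    Function.injective_id.sumMap ((Fin.succ_injective k).sumMap Function.injective_id)
  have hφR : Function.Injective φR := by
    rintro (i | i) (j | j) <;> simp [φR]
  have hrG : ∀ v, v ≠ Sum.inr (Sum.inl 0) ↔ ∃ i, φG i = v := by
    rintro (v | v | v) <;> simp [φG, Fin.exists_succ_eq]
  have hrR : ∀ v, v ≠ Sum.inr 0 ↔ ∃ i, φR i = v := by
    rintro (v | v) <;> simp [φR, Fin.exists_succ_eq]
  have hrL : ∀ v : Option (Fin n), v ≠ none ↔ ∃ i, some i = v := fun _ =>
    Option.ne_none_iff_exists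
  have hwG : G.w = (Sum.elim (fun e => w₁ e.1) (Sum.elim wC wA) :
      (E₁ × Bool) ⊕ (EC ⊕ EA) → ℚ) := by
    funext e
    rcases e with ⟨e, b⟩ | c | a <;> rfl
  have hwR : Gright.w = (Sum.elim w₁ fun c => wC c / 2 : E₁ ⊕ EC → ℚ) := by
    funext e
    rcases e with e | c <;> rfl
  have hwL : Gleft.w = (Sum.elim w₁ fun a => 2 * wA a : E₁ ⊕ EA → ℚ) := by
    funext e
    rcases e with e | a <;> rfl
  have hτG := G.treeWeight_eq_det hG hφG hrG
  have hτR := Gright.treeWeight_eq_det hR hφR hrR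
  have hτL := Gleft.treeWeight_eq_det hL (Option.some_injective _) hrL
  rw [hwG] at hτG
  rw [hwR] at hτR
  rw [hwL] at hτL
  let A := WMGraph.incidence ℚ s₁ t₁ (Sum.inl : Fin n → Fin n ⊕ Fin (k + 1))
  let C := WMGraph.incidence ℚ s₁ t₁ (fun j : Fin k => (Sum.inr j.succ : Fin n ⊕ Fin (k + 1)))
  let D := WMGraph.incidence ℚ sC tC (Fin.succ : Fin k → Fin (k + 1))
  let F := WMGraph.incidence ℚ (fun a => some (idxA a)) (fun _ : EA => none) (some : Fin n → _)
  have hBR : WMGraph.incidence ℚ srcR tgtR φR = Matrix.fromBlocks C A D 0 := by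
    ext (e | c) (j | i) <;> simp [WMGraph.incidence, srcR, tgtR, φR, A, C, D] <;> rfl
  have hBL : WMGraph.incidence ℚ srcL tgtL some = Matrix.fromRows A F := by
    ext (e | a) i
    · rcases hs : s₁ e with v | v <;> rcases ht : t₁ e with v' | v' <;>
        simp [WMGraph.incidence, srcL, tgtL, merge, A, hs, ht]
    · simp [WMGraph.incidence, srcL, tgtL, F]
  have hBG : WMGraph.incidence ℚ srcG tgtG φG = Matrix.of (Sum.elim
      (fun e => if e.2 then Sum.elim 0 (Sum.elim (C e.1) (A e.1))
        else Sum.elim (A e.1) (Sum.elim (C e.1) 0))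
      (Sum.elim (fun c => Sum.elim 0 (Sum.elim (D c) 0))
        fun a => Sum.elim (F a) (Sum.elim 0 (-F a)))) := by
    ext e v
    rcases e with ⟨e, _ | _⟩ | c | a
    · rcases hs : s₁ e with x | x <;> rcases ht : t₁ e with y | y <;> rcases v with i | j | i <;>
        simp [WMGraph.incidence, srcG, tgtG, φG, leftEmb, A, C, hs, ht]
    · rcases hs : s₁ e with x | x <;> rcases ht : t₁ e with y | y <;> rcases v with i | j | i <;>
        simp [WMGraph.incidence, srcG, tgtG, φG, rightEmb, A, C, hs, ht]
    · rcases v with i | j | i <;> simp [WMGraph.incidence, srcG, tgtG, φG, D]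
    · rcases v with i | j | i <;> simp [WMGraph.incidence, srcG, tgtG, φG, F]
  have hmain := Matrix.det_mirror_gram two_ne_zero A C D F w₁ wC wA hBG
  rw [Fintype.card_fin, ← hBL, ← hBR] at hmain
  rw [hτG, hτR, hτL]
  exact hmain
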